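/- arXiv:2410.08951 — 3 statements merged into one kernel-verified Lean document; each statement's English description precedes it below -/
import Mathlib

section
/- Under the stated hypotheses on Φ and f (a local diffeomorphism with triangular component structure, with X2 = x2·K, X3 = x3·H, X5 = x5·G, conjugating Z_{1,c} to f·(Z_{1,c̃}∘Φ) modulo span{∂_{x5}, ∂_{y5}}), one necessarily has c = c̃. -/
noncomputable section

/-- The model space `ℝ^13` with coordinates
`(t, x0, y0, x1, y1, x2, y2, x3, y3, x4, y4, x5, y5)`
indexed by `0, 1, ..., 12` respectively. -/
abbrev E13 := Fin 13 → ℝ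

/-- The constant coordinate vector field `∂_u` of the `i`-th coordinate. -/
def e (i : Fin 13) : E13 := Pi.single i 1

/-- Partial derivative of a scalar function `F` in the `i`-th coordinate
direction, at a point `p`. -/
def pd (F : E13 → ℝ) (i : Fin 13) (p : E13) : ℝ := fderiv ℝ F p (e i)

/-- The vector field `Z_{1,a}` of the EKR pseudo-normal form for the
singularity class 1.2.3.1.2:
`Z_{1,a} = ∂_{x4} + (a + y5)·∂_{y4} + x5·( y3·∂_{x2} + (1 + x4)·∂_{x3}
 + (1 + y4)·∂_{y3} + x3·( ∂_{x1} + y2·∂_{y1} + x2·( ∂_t + x1·∂_{x0} + y1·∂_{y0} ) ) )`. -/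
def Z (a : ℝ) (p : E13) : E13 :=
  e 9 + (a + p 12) • e 10 +
    p 11 • (p 8 • e 5 + (1 + p 9) • e 7 + (1 + p 10) • e 8 +
      p 7 • (e 3 + p 6 • e 4 + p 5 • (e 0 + p 3 • e 1 + p 4 • e 2)))

open Filter Topology

lemma tendsto_line (p v : E13) : Tendsto (fun s : ℝ => p + s • v) (𝓝 0) (𝓝 p) := by
  have h : Continuous fun s : ℝ => p + s • v := by fun_prop
  simpa using h.tendsto 0

lemma hasDerivAt_line {F : E13 → E13} {p : E13} (hF : DifferentiableAt ℝ F p) (v : E13)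
    (i : Fin 13) : HasDerivAt (fun s : ℝ => F (p + s • v) i) (fderiv ℝ F p v i) 0 := by
  have hline : HasDerivAt (fun s : ℝ => p + s • v) v 0 := by
    simpa using ((hasDerivAt_id (0 : ℝ)).smul_const v).const_add p
  have hF' : HasFDerivAt F (fderiv ℝ F p) (p + (0 : ℝ) • v) := by
    simpa using hF.hasFDerivAt
  exact hasDerivAt_pi.1 (hF'.comp_hasDerivAt (0 : ℝ) hline) i

lemma fderiv_apply_congr {F : E13 → E13} {p q : E13} (hp : DifferentiableAt ℝ F p)
    (hq : DifferentiableAt ℝ F q) {v : E13} {i : Fin 13}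
    (h : ∀ s : ℝ, F (p + s • v) i = F (q + s • v) i) :
    fderiv ℝ F p v i = fderiv ℝ F q v i := by
  have hd := hasDerivAt_line hp v i
  simp only [h] at hd
  exact hd.unique (hasDerivAt_line hq v i)

lemma fderiv_apply_eq_of_eventually {F : E13 → E13} {p : E13} (hp : DifferentiableAt ℝ F p)
    {v : E13} {i : Fin 13} (b m : ℝ) (h : ∀ᶠ s : ℝ in 𝓝 0, F (p + s • v) i = b + s * m) :
    fderiv ℝ F p v i = m := by
  have hm : HasDerivAt (fun s : ℝ => b + s * m) m 0 := by
    simpa using ((hasDerivAt_id (0 : ℝ)).mul_const m).const_add b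
  exact (hasDerivAt_line hp v i).unique (hm.congr_of_eventuallyEq h)

/-- A continuous function on an open set can be cancelled against a coordinate. -/
lemma eq_zero_of_coord_mul_eq_zero {U : Set E13} (hU : IsOpen U) {g : E13 → ℝ}
    (hg : ContinuousOn g U) (k : Fin 13) (h : ∀ p ∈ U, p k * g p = 0) :
    ∀ p ∈ U, g p = 0 := by
  intro p hp
  by_cases hk : p k = 0
  · have hlim : Tendsto (fun s : ℝ => g (p + s • e k)) (𝓝[≠] 0) (𝓝 (g p)) :=
      ((hg.continuousAt (hU.mem_nhds hp)).tendsto.comp (tendsto_line p (e k))).mono_left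
        nhdsWithin_le_nhds
    refine tendsto_nhds_unique_of_eventuallyEq hlim tendsto_const_nhds ?_
    filter_upwards [self_mem_nhdsWithin, nhdsWithin_le_nhds
      ((tendsto_line p (e k)).eventually (hU.mem_nhds hp))] with s hs hsU
    have := h _ hsU
    simp only [e, Pi.add_apply, hk, Pi.smul_apply, Pi.single_eq_same, smul_eq_mul, mul_one,
      zero_add] at this
    exact (mul_eq_zero.1 this).resolve_left hs
  · exact (mul_eq_zero.1 (h p hp)).resolve_left hk

/-- Under the stated hypotheses on `Φ` and `f`, necessarily `c = c'`. -/
theorem conjugation_forces_equal_parameters_12312 (c c' : ℝ)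
    (Φ : E13 → E13) (U : Set E13) (hU : IsOpen U) (h0U : (0 : E13) ∈ U)
    (hΦsmooth : ContDiffOn ℝ (⊤ : ℕ∞) Φ U) (hΦ0 : Φ 0 = 0)
    (hdiffeo : Function.Bijective (fderiv ℝ Φ 0))
    -- the components `T, X0, Y0` (indices 0,1,2) depend only on `t, x0, y0`
    (htri0 : ∀ p q : E13, (∀ k : Fin 13, (k : ℕ) ≤ 2 → p k = q k) →
      ∀ i : Fin 13, (i : ℕ) ≤ 2 → Φ p i = Φ q i)
    -- for `1 ≤ j ≤ 5`, the components `Xj, Yj` (indices 2j+1, 2j+2)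
    -- depend only on `t, x0, y0, x1, y1, ..., xj, yj`
    (htri : ∀ j : ℕ, 1 ≤ j → j ≤ 5 → ∀ p q : E13,
      (∀ k : Fin 13, (k : ℕ) ≤ 2 * j + 2 → p k = q k) →
      ∀ i : Fin 13, ((i : ℕ) = 2 * j + 1 ∨ (i : ℕ) = 2 * j + 2) → Φ p i = Φ q i)
    (K H G : E13 → ℝ)
    (hKs : ContDiffOn ℝ (⊤ : ℕ∞) K U) (hHs : ContDiffOn ℝ (⊤ : ℕ∞) H U) (hGs : ContDiffOn ℝ (⊤ : ℕ∞) G U)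
    (hK0 : K 0 ≠ 0) (hH0 : H 0 ≠ 0) (hG0 : G 0 ≠ 0)
    -- `X2 = x2·K`, `X3 = x3·H`, `X5 = x5·G`
    (hX2 : ∀ p ∈ U, Φ p 5 = p 5 * K p)
    (hX3 : ∀ p ∈ U, Φ p 7 = p 7 * H p)
    (hX5 : ∀ p ∈ U, Φ p 11 = p 11 * G p)
    (f : E13 → ℝ) (hfs : ContDiffOn ℝ (⊤ : ℕ∞) f U) (hf0 : f 0 ≠ 0)
    -- `dΦ(p)·Z_{1,c}(p) − f(p)·Z_{1,c'}(Φ(p)) ∈ span{∂_{x5}, ∂_{y5}}` near 0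
    (hconj : ∀ p ∈ U, fderiv ℝ Φ p (Z c p) - f p • Z c' (Φ p) ∈
      Submodule.span ℝ ({e 11, e 12} : Set E13)) :
    c = c' := by
  have hdiff : ∀ p ∈ U, DifferentiableAt ℝ Φ p := fun p hp =>
    (hΦsmooth.contDiffAt (hU.mem_nhds hp)).differentiableAt (by simp)
  have hfd : ContinuousOn (fderiv ℝ Φ) U :=
    hΦsmooth.continuousOn_fderiv_of_isOpen hU (by simp)
  have hΦc := hΦsmooth.continuousOn
  have hfc := hfs.continuousOn
  have hGc := hGs.continuousOn
  have hM : ∀ i k, ContinuousOn (fun p => fderiv ℝ Φ p (e k) i) U := fun i k =>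
    (continuous_apply i).comp_continuousOn (hfd.clm_apply continuousOn_const)
  have hcomp : ∀ p ∈ U, ∀ i : Fin 13, i ≠ 11 → i ≠ 12 →
      fderiv ℝ Φ p (Z c p) i = f p * Z c' (Φ p) i := by
    intro p hp i h11 h12
    obtain ⟨a, b, hab⟩ := Submodule.mem_span_pair.1 (hconj p hp)
    have := congrFun hab i
    simp [e, h11, h12] at this
    linarith
  -- Triangularity: derivatives in the higher coordinates vanish.
  have hvanish : ∀ p ∈ U, ∀ j : ℕ, 1 ≤ j → j ≤ 5 → ∀ i k : Fin 13,
      ((i : ℕ) = 2 * j + 1 ∨ (i : ℕ) = 2 * j + 2) → 2 * j + 2 < (k : ℕ) →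
      fderiv ℝ Φ p (e k) i = 0 := by
    intro p hp j h1 h5 i k hi hk
    refine fderiv_apply_eq_of_eventually (hdiff p hp) (Φ p i) 0 (Eventually.of_forall ?_)
    intro s
    rw [mul_zero, add_zero]
    refine htri j h1 h5 _ _ (fun l hl => ?_) i hi
    have : l ≠ k := by rintro rfl; omega
    simp [e, this]
  have hindep : ∀ p ∈ U, ∀ j : ℕ, 1 ≤ j → j ≤ 5 → ∀ i k : Fin 13,
      ((i : ℕ) = 2 * j + 1 ∨ (i : ℕ) = 2 * j + 2) →
      (∀ l : Fin 13, (l : ℕ) ≤ 2 * j + 2 → p l = 0) →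
      fderiv ℝ Φ p (e k) i = fderiv ℝ Φ 0 (e k) i := by
    intro p hp j h1 h5 i k hi hl
    refine fderiv_apply_congr (hdiff p hp) (hdiff 0 h0U) fun s => ?_
    refine htri j h1 h5 _ _ (fun l hl' => ?_) i hi
    simp [hl l hl']
  have heqX2 : ∀ p ∈ U, p 8 * fderiv ℝ Φ p (e 5) 5 + p 7 * (fderiv ℝ Φ p (e 3) 5 +
      p 6 * fderiv ℝ Φ p (e 4) 5 + p 5 * (fderiv ℝ Φ p (e 0) 5 + p 3 * fderiv ℝ Φ p (e 1) 5 +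
      p 4 * fderiv ℝ Φ p (e 2) 5)) - f p * G p * Φ p 8 = 0 := by
    refine eq_zero_of_coord_mul_eq_zero hU ?_ 11 fun p hp => ?_
    · fun_prop
    · have h := hcomp p hp 5 (by decide) (by decide)
      have hv := fun k hk => hvanish p hp 2 (by norm_num) (by norm_num) 5 k (by simp) hk
      have h7 := hv 7 (by decide)
      have h8 := hv 8 (by decide)
      have h9 := hv 9 (by decide)
      have h10 := hv 10 (by decide)
      simp only [Z, map_add, map_smul, Pi.add_apply, Pi.smul_apply, smul_eq_mul,
        h7, h8, h9, h10] at h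
      simp [e, hX5 p hp] at h
      simp only [e]
      linarith
  have heqX3 : ∀ p ∈ U, p 8 * fderiv ℝ Φ p (e 5) 7 + (1 + p 9) * fderiv ℝ Φ p (e 7) 7 +
      (1 + p 10) * fderiv ℝ Φ p (e 8) 7 + p 7 * (fderiv ℝ Φ p (e 3) 7 +
      p 6 * fderiv ℝ Φ p (e 4) 7 + p 5 * (fderiv ℝ Φ p (e 0) 7 + p 3 * fderiv ℝ Φ p (e 1) 7 +
      p 4 * fderiv ℝ Φ p (e 2) 7)) - f p * G p * (1 + Φ p 9) = 0 := by
    refine eq_zero_of_coord_mul_eq_zero hU ?_ 11 fun p hp => ?_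
    · fun_prop
    · have h := hcomp p hp 7 (by decide) (by decide)
      have hv := fun k hk => hvanish p hp 3 (by norm_num) (by norm_num) 7 k (by simp) hk
      have h9 := hv 9 (by decide)
      have h10 := hv 10 (by decide)
      simp only [Z, map_add, map_smul, Pi.add_apply, Pi.smul_apply, smul_eq_mul, h9, h10] at h
      simp [e, hX5 p hp] at h
      simp only [e]
      linarith
  have heqY3 : ∀ p ∈ U, p 8 * fderiv ℝ Φ p (e 5) 8 + (1 + p 9) * fderiv ℝ Φ p (e 7) 8 +
      (1 + p 10) * fderiv ℝ Φ p (e 8) 8 + p 7 * (fderiv ℝ Φ p (e 3) 8 +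
      p 6 * fderiv ℝ Φ p (e 4) 8 + p 5 * (fderiv ℝ Φ p (e 0) 8 + p 3 * fderiv ℝ Φ p (e 1) 8 +
      p 4 * fderiv ℝ Φ p (e 2) 8)) - f p * G p * (1 + Φ p 10) = 0 := by
    refine eq_zero_of_coord_mul_eq_zero hU ?_ 11 fun p hp => ?_
    · fun_prop
    · have h := hcomp p hp 8 (by decide) (by decide)
      have hv := fun k hk => hvanish p hp 3 (by norm_num) (by norm_num) 8 k (by simp) hk
      have h9 := hv 9 (by decide)
      have h10 := hv 10 (by decide)
      simp only [Z, map_add, map_smul, Pi.add_apply, Pi.smul_apply, smul_eq_mul, h9, h10] at h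
      simp [e, hX5 p hp] at h
      simp only [e]
      linarith
  have hA0 : f 0 * G 0 ≠ 0 := mul_ne_zero hf0 hG0
  have hAc : ∀ p ∈ U, ContinuousAt (fun p => f p * G p) p := fun p hp =>
    (hfc.mul hGc).continuousAt (hU.mem_nhds hp)
  have hnear : ∀ p ∈ U, ∀ v : E13, ∀ᶠ s : ℝ in 𝓝 0, p + s • v ∈ U := fun p hp v =>
    (tendsto_line p v).eventually (hU.mem_nhds hp)
  have hX2x2 : fderiv ℝ Φ 0 (e 5) 5 ≠ 0 := by
    have hlim := (hasDerivAt_iff_tendsto_slope.1 (hasDerivAt_line (hdiff 0 h0U) (e 5) 5))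
    have hK : Tendsto (fun s : ℝ => K (0 + s • e 5)) (𝓝[≠] 0) (𝓝 (K 0)) :=
      ((hKs.continuousOn.continuousAt (hU.mem_nhds h0U)).tendsto.comp
        (tendsto_line 0 (e 5))).mono_left nhdsWithin_le_nhds
    have heq : fderiv ℝ Φ 0 (e 5) 5 = K 0 := by
      refine tendsto_nhds_unique_of_eventuallyEq hlim hK ?_
      filter_upwards [self_mem_nhdsWithin, nhdsWithin_le_nhds (hnear 0 h0U (e 5))] with s hs hsU
      have hs' : s ≠ 0 := hs
      have h := hX2 _ hsU
      simp only [slope_def_field, h, zero_smul, add_zero, hΦ0]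
      simp [e]
      field_simp
    rwa [heq]
  -- `Y3` vanishes on the `x3`-axis.
  have hY3x3 : fderiv ℝ Φ 0 (e 7) 8 = 0 := by
    refine fderiv_apply_eq_of_eventually (hdiff 0 h0U) 0 0 ?_
    have hne : ∀ᶠ s : ℝ in 𝓝 0, f (0 + s • e 7) * G (0 + s • e 7) ≠ 0 :=
      ((hAc 0 h0U).tendsto.comp (tendsto_line 0 (e 7))).eventually_ne hA0
    filter_upwards [hne, hnear 0 h0U (e 7)] with s hs hsU
    have h := heqX2 _ hsU
    have h53 : fderiv ℝ Φ (0 + s • e 7) (e 3) 5 = 0 := by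
      refine fderiv_apply_eq_of_eventually (hdiff _ hsU) 0 0 ?_
      filter_upwards [hnear _ hsU (e 3)] with r hr
      rw [hX2 _ hr]
      simp [e]
    rw [h53] at h
    have h5 : (0 + s • e 7 : E13) 5 = 0 := by simp [e]
    have h6 : (0 + s • e 7 : E13) 6 = 0 := by simp [e]
    have h8 : (0 + s • e 7 : E13) 8 = 0 := by simp [e]
    rw [h5, h6, h8] at h
    have h' : f (0 + s • e 7) * G (0 + s • e 7) * Φ (0 + s • e 7) 8 = 0 := by linarith
    simpa using (mul_eq_zero.1 h').resolve_left hs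
  -- `f * G` is constant where the coordinates below `x4` vanish.
  have hAconst : ∀ w ∈ U, (∀ l : Fin 13, (l : ℕ) ≤ 8 → w l = 0) →
      f w * G w = f 0 * G 0 := by
    intro w hw hw0
    have hlim : ∀ p ∈ U, Tendsto (fun r : ℝ => f (p + r • e 8) * G (p + r • e 8)) (𝓝[≠] 0)
        (𝓝 (f p * G p)) := fun p hp =>
      ((hAc p hp).tendsto.comp (tendsto_line p (e 8))).mono_left nhdsWithin_le_nhds
    refine tendsto_nhds_unique_of_eventuallyEq (hlim w hw) (hlim 0 h0U) ?_
    have hval : ∀ p : E13, (∀ l : Fin 13, (l : ℕ) ≤ 8 → p l = 0) → ∀ r : ℝ, p + r • e 8 ∈ U →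
        r * fderiv ℝ Φ 0 (e 5) 5 =
          f (p + r • e 8) * G (p + r • e 8) * Φ (p + r • e 8) 8 := by
      intro p hp r hr
      have h := heqX2 _ hr
      rw [hindep _ hr 2 (by norm_num) (by norm_num) 5 5 (by simp) (fun l hl => by
        have : l ≠ 8 := by rintro rfl; simp at hl
        simp [e, this, hp l (by omega)])] at h
      have h7 : (p + r • e 8 : E13) 7 = 0 := by simp [e, hp 7 (by decide)]
      have h8 : (p + r • e 8 : E13) 8 = r := by simp [e, hp 8 (by decide)]
      rw [h7, h8] at h
      linarith
    filter_upwards [self_mem_nhdsWithin, nhdsWithin_le_nhds (hnear w hw (e 8)),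
      nhdsWithin_le_nhds (hnear 0 h0U (e 8))] with r hr hrw hr0
    have h1 := hval w hw0 r hrw
    have h2 := hval 0 (fun _ _ => rfl) r hr0
    have hY : Φ (w + r • e 8) 8 = Φ (0 + r • e 8) 8 :=
      htri 3 (by norm_num) (by norm_num) _ _ (fun l hl => by simp [hw0 l hl]) 8 (by simp)
    have hne : Φ (0 + r • e 8) 8 ≠ 0 := by
      intro h0
      rw [h0, mul_zero] at h2
      exact mul_ne_zero hr hX2x2 h2
    rw [hY] at h1
    exact mul_right_cancel₀ hne (h1.symm.trans h2)
  -- The induced values of `X4` and `Y4` where the lower coordinates vanish.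
  have hX4Y4 : ∀ w ∈ U, (∀ l : Fin 13, (l : ℕ) ≤ 8 → w l = 0) →
      (1 + w 9) * fderiv ℝ Φ 0 (e 7) 7 = f 0 * G 0 * (1 + Φ w 9) ∧
      (1 + w 10) * fderiv ℝ Φ 0 (e 8) 8 = f 0 * G 0 * (1 + Φ w 10) := by
    intro w hw hw0
    have hi := fun i k hi => hindep w hw 3 (by norm_num) (by norm_num) i k hi hw0
    have h78 : fderiv ℝ Φ w (e 8) 7 = 0 := by
      refine fderiv_apply_eq_of_eventually (hdiff _ hw) 0 0 ?_
      filter_upwards [hnear _ hw (e 8)] with r hr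
      rw [hX3 _ hr]
      simp [e, hw0 7 (by decide)]
    have h7 := heqX3 w hw
    have h8 := heqY3 w hw
    rw [hw0 7 (by decide), hw0 8 (by decide), hAconst w hw hw0] at h7 h8
    rw [h78, hi 7 7 (by simp)] at h7
    rw [hi 8 7 (by simp), hi 8 8 (by simp), hY3x3] at h8
    exact ⟨by linarith, by linarith⟩
  obtain ⟨hH, hY⟩ := hX4Y4 0 h0U fun _ _ => rfl
  simp only [hΦ0, Pi.zero_apply, add_zero, one_mul, mul_one] at hH hY
  have hline : ∀ᶠ s : ℝ in 𝓝 0,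
      Φ (0 + s • Z c 0) 9 = 0 + s * 1 ∧ Φ (0 + s • Z c 0) 10 = 0 + s * c := by
    filter_upwards [hnear 0 h0U (Z c 0)] with s hs
    obtain ⟨h9, h10⟩ := hX4Y4 _ hs fun l hl => by
      have h9 : l ≠ 9 := by rintro rfl; simp at hl
      have h10 : l ≠ 10 := by rintro rfl; simp at hl
      simp [Z, e, h9, h10]
    rw [hH, mul_comm] at h9
    rw [hY, mul_comm] at h10
    have h9' := mul_left_cancel₀ hA0 h9
    have h10' := mul_left_cancel₀ hA0 h10
    have e9 : (0 + s • Z c 0 : E13) 9 = s := by simp [Z, e]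
    have e10 : (0 + s • Z c 0 : E13) 10 = s * c := by simp [Z, e]
    rw [e9] at h9'
    rw [e10] at h10'
    exact ⟨by linarith, by linarith⟩
  have hd9 := fderiv_apply_eq_of_eventually (hdiff 0 h0U) 0 1 (hline.mono fun _ h => h.1)
  have hd10 := fderiv_apply_eq_of_eventually (hdiff 0 h0U) 0 c (hline.mono fun _ h => h.2)
  have hf1 : f 0 = 1 := by
    have h := hcomp 0 h0U 9 (by decide) (by decide)
    rw [hd9, hΦ0] at h
    simpa [Z, e] using h.symm
  have h := hcomp 0 h0U 10 (by decide) (by decide)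
  rw [hd10, hΦ0, hf1] at h
  simpa [Z, e] using h
end
end

section
/- Under the stated hypotheses on Φ and f, one has: H(0) = f(0)·G(0), X4_{x4}(0) = 1, X4_{y4}(0) = 0, and consequently f(0) = 1. -/
noncomputable section

lemma Z_apply_five (a : ℝ) (p : E13) : Z a p 5 = p 11 * p 8 := by
  simp [Z, e]

lemma Z_apply_seven (a : ℝ) (p : E13) : Z a p 7 = p 11 * (1 + p 9) := by
  simp [Z, e]

lemma Z_apply_nine (a : ℝ) (p : E13) : Z a p 9 = 1 := by
  simp [Z, e]

lemma Z_zero (a : ℝ) : Z a 0 = e 9 + a • e 10 := by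
  simp [Z]

lemma apply_eq_zero_of_mem_span {v : E13}
    (hv : v ∈ Submodule.span ℝ ({e 11, e 12} : Set E13)) {i : Fin 13}
    (h11 : i ≠ 11) (h12 : i ≠ 12) : v i = 0 := by
  obtain ⟨a, b, rfl⟩ := Submodule.mem_span_pair.1 hv
  simp [e, h11, h12]

/-- The differential of `x_i · K` along the hyperplane `x_i = 0`. -/
lemma fderiv_of_eq_coord_mul {U : Set E13} (hU : IsOpen U) {F K : E13 → ℝ} {i : Fin 13}
    (hF : ∀ p ∈ U, F p = p i * K p) {p : E13} (hp : p ∈ U) (hK : DifferentiableAt ℝ K p)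
    (hpi : p i = 0) (v : E13) : fderiv ℝ F p v = v i * K p := by
  have hFK : F =ᶠ[nhds p] fun q => q i * K q :=
    Filter.eventually_of_mem (hU.mem_nhds hp) hF
  rw [hFK.fderiv_eq, fderiv_fun_mul (by fun_prop) hK]
  have hproj : fderiv ℝ (fun q : E13 => q i) p v = v i := by
    rw [(hasFDerivAt_apply i p).fderiv]
    rfl
  simp [hpi, hproj, mul_comm]

/-- If `F = x_i · K` is a function of the first `n + 1` coordinates only, then so is the
restriction of `K` to the hyperplane `x_i = 0`. -/
lemma quotient_eq_of_coords_eq {U : Set E13} (hU : IsOpen U) {F K : E13 → ℝ} {i : Fin 13}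
    (hF : ∀ p ∈ U, F p = p i * K p) (hK : ∀ p ∈ U, DifferentiableAt ℝ K p) {n : ℕ}
    (htri : ∀ p q : E13, (∀ k : Fin 13, (k : ℕ) ≤ n → p k = q k) → F p = F q)
    {p q : E13} (hp : p ∈ U) (hq : q ∈ U) (hpi : p i = 0) (hqi : q i = 0)
    (hpq : ∀ k : Fin 13, (k : ℕ) ≤ n → p k = q k) : K p = K q := by
  have hinv : (fun x => F (x + (q - p))) = F := by
    funext x
    refine htri _ _ fun k hk => ?_
    simp [hpq k hk]
  have hder : fderiv ℝ F p = fderiv ℝ F q := by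
    have h := fderiv_comp_add_right (𝕜 := ℝ) (f := F) (x := p) (q - p)
    rwa [hinv, add_sub_cancel] at h
  have hp' := fderiv_of_eq_coord_mul hU hF hp (hK p hp) hpi (e i)
  have hq' := fderiv_of_eq_coord_mul hU hF hq (hK q hq) hqi (e i)
  rw [hder, hq'] at hp'
  simpa [e] using hp'.symm

/-- The point whose only possibly nonzero coordinates are `y3, x4, y4, x5`. -/
def slicePoint (s u v w : ℝ) : E13 := ![0, 0, 0, 0, 0, 0, 0, 0, s, u, v, w, 0]

lemma slicePoint_mem_ball {s u v w ε : ℝ} (hε : 0 < ε) (hs : |s| < ε) (hu : |u| < ε)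
    (hv : |v| < ε) (hw : |w| < ε) : slicePoint s u v w ∈ Metric.ball (0 : E13) ε := by
  rw [mem_ball_zero_iff, pi_norm_lt_iff hε]
  intro i
  fin_cases i <;> simp [slicePoint, hε, hs, hu, hv, hw]

lemma slicePoint_apply_eq {s u v w u' v' w' : ℝ} {k : Fin 13} (hk : (k : ℕ) ≤ 8) :
    slicePoint s u v w k = slicePoint s u' v' w' k := by
  revert hk
  fin_cases k <;> simp [slicePoint]

lemma slicePoint_apply_eq_of_le_ten {s u v w w' : ℝ} {k : Fin 13} (hk : (k : ℕ) ≤ 10) :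
    slicePoint s u v w k = slicePoint s u v w' k := by
  revert hk
  fin_cases k <;> simp [slicePoint]

lemma slicePoint_zero : slicePoint 0 0 0 0 = 0 := by
  funext k
  fin_cases k <;> rfl

lemma smul_e_nine (r : ℝ) : r • e 9 = slicePoint 0 r 0 0 := by
  funext k
  fin_cases k <;> simp [slicePoint, e]

lemma smul_e_ten (r : ℝ) : r • e 10 = slicePoint 0 0 r 0 := by
  funext k
  fin_cases k <;> simp [slicePoint, e]

lemma continuous_slicePoint_y3 (u v w : ℝ) : Continuous fun s => slicePoint s u v w := by
  refine continuous_pi fun k => ?_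
  fin_cases k <;> simp only [slicePoint] <;> first | exact continuous_const | exact continuous_id

lemma continuous_slicePoint_x5 (s u v : ℝ) : Continuous fun w => slicePoint s u v w := by
  refine continuous_pi fun k => ?_
  fin_cases k <;> simp only [slicePoint] <;> first | exact continuous_const | exact continuous_id

lemma pd_zero_of_eventually {F : E13 → ℝ} {i : Fin 13} {a : ℝ} (hF : DifferentiableAt ℝ F 0)
    (h : ∀ᶠ r : ℝ in nhds 0, F (r • e i) = r * a) : pd F i 0 = a := by
  rw [pd, ← hF.lineDeriv_eq_fderiv, lineDeriv]
  have h' : (fun r : ℝ => F (0 + r • e i)) =ᶠ[nhds 0] fun r => r * a := by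
    filter_upwards [h] with r hr
    rwa [zero_add]
  rw [h'.deriv_eq]
  simp

/-- `H(0) = f(0)·G(0)`, `X4_{x4}(0) = 1`, `X4_{y4}(0) = 0`, and consequently `f(0) = 1`. -/
theorem normalizations_12312 (c c' : ℝ)
    (Φ : E13 → E13) (U : Set E13) (hU : IsOpen U) (h0U : (0 : E13) ∈ U)
    (hΦsmooth : ContDiffOn ℝ (⊤ : ℕ∞) Φ U) (hΦ0 : Φ 0 = 0)
    (hdiffeo : Function.Bijective (fderiv ℝ Φ 0))
    -- the components `T, X0, Y0` (indices 0,1,2) depend only on `t, x0, y0`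
    (htri0 : ∀ p q : E13, (∀ k : Fin 13, (k : ℕ) ≤ 2 → p k = q k) →
      ∀ i : Fin 13, (i : ℕ) ≤ 2 → Φ p i = Φ q i)
    -- for `1 ≤ j ≤ 5`, the components `Xj, Yj` (indices 2j+1, 2j+2)
    -- depend only on `t, x0, y0, x1, y1, ..., xj, yj`
    (htri : ∀ j : ℕ, 1 ≤ j → j ≤ 5 → ∀ p q : E13,
      (∀ k : Fin 13, (k : ℕ) ≤ 2 * j + 2 → p k = q k) →
      ∀ i : Fin 13, ((i : ℕ) = 2 * j + 1 ∨ (i : ℕ) = 2 * j + 2) → Φ p i = Φ q i)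
    (K H G : E13 → ℝ)
    (hKs : ContDiffOn ℝ (⊤ : ℕ∞) K U) (hHs : ContDiffOn ℝ (⊤ : ℕ∞) H U) (hGs : ContDiffOn ℝ (⊤ : ℕ∞) G U)
    (hK0 : K 0 ≠ 0) (hH0 : H 0 ≠ 0) (hG0 : G 0 ≠ 0)
    -- `X2 = x2·K`, `X3 = x3·H`, `X5 = x5·G`
    (hX2 : ∀ p ∈ U, Φ p 5 = p 5 * K p)
    (hX3 : ∀ p ∈ U, Φ p 7 = p 7 * H p)
    (hX5 : ∀ p ∈ U, Φ p 11 = p 11 * G p)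
    (f : E13 → ℝ) (hfs : ContDiffOn ℝ (⊤ : ℕ∞) f U) (hf0 : f 0 ≠ 0)
    -- `dΦ(p)·Z_{1,c}(p) − f(p)·Z_{1,c'}(Φ(p)) ∈ span{∂_{x5}, ∂_{y5}}` near 0
    (hconj : ∀ p ∈ U, fderiv ℝ Φ p (Z c p) - f p • Z c' (Φ p) ∈
      Submodule.span ℝ ({e 11, e 12} : Set E13)) :
    H 0 = f 0 * G 0 ∧ pd (fun p => Φ p 9) 9 0 = 1 ∧
      pd (fun p => Φ p 9) 10 0 = 0 ∧ f 0 = 1 := by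
  have hKd : ∀ p ∈ U, DifferentiableAt ℝ K p := fun p hp =>
    (hKs.contDiffAt (hU.mem_nhds hp)).differentiableAt (by simp)
  have hHd : ∀ p ∈ U, DifferentiableAt ℝ H p := fun p hp =>
    (hHs.contDiffAt (hU.mem_nhds hp)).differentiableAt (by simp)
  have hΦd : ∀ p ∈ U, DifferentiableAt ℝ Φ p := fun p hp =>
    (hΦsmooth.contDiffAt (hU.mem_nhds hp)).differentiableAt (by simp)
  have hGc : ContinuousAt G 0 := hGs.continuousOn.continuousAt (hU.mem_nhds h0U)
  have hfc : ContinuousAt f 0 := hfs.continuousOn.continuousAt (hU.mem_nhds h0U)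
  have hcomp : ∀ p ∈ U, ∀ i : Fin 13, i ≠ 11 → i ≠ 12 →
      fderiv ℝ (fun q => Φ q i) p (Z c p) = f p * Z c' (Φ p) i := by
    intro p hp i h11 h12
    have h := apply_eq_zero_of_mem_span (hconj p hp) h11 h12
    rw [fderiv_apply (hΦd p hp)]
    simpa [sub_eq_zero] using h
  have hx2 : ∀ p ∈ U, p 5 = 0 → p 11 * p 8 * K p = f p * (p 11 * G p * Φ p 8) := by
    intro p hp hp5
    have h := hcomp p hp 5 (by decide) (by decide)
    rwa [fderiv_of_eq_coord_mul hU hX2 hp (hKd p hp) hp5, Z_apply_five, Z_apply_five,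
      hX5 p hp] at h
  have hx3 : ∀ p ∈ U, p 7 = 0 →
      p 11 * (1 + p 9) * H p = f p * (p 11 * G p * (1 + Φ p 9)) := by
    intro p hp hp7
    have h := hcomp p hp 7 (by decide) (by decide)
    rwa [fderiv_of_eq_coord_mul hU hX3 hp (hHd p hp) hp7, Z_apply_seven, Z_apply_seven,
      hX5 p hp] at h
  have hnear : ∀ᶠ p in nhds (0 : E13), p ∈ U ∧ f p ≠ 0 ∧ G p ≠ 0 ∧ K p ≠ 0 :=
    (hU.eventually_mem h0U).and <| (hfc.eventually_ne hf0).and <|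
      (hGc.eventually_ne hG0).and ((hKd 0 h0U).continuousAt.eventually_ne hK0)
  obtain ⟨ε, hε, hball⟩ := Metric.eventually_nhds_iff_ball.1 hnear
  have habs : |ε / 2| < ε := by rw [abs_of_pos (half_pos hε)]; exact half_lt_self hε
  have habs0 : |(0 : ℝ)| < ε := by simpa using hε
  have hε2 : ε / 2 ≠ 0 := (half_pos hε).ne'
  have hΦ9 : ∀ s u v w w', Φ (slicePoint s u v w) 9 = Φ (slicePoint s u v w') 9 :=
    fun s u v w w' => htri 4 (by norm_num) (by norm_num) _ _
      (fun k hk => slicePoint_apply_eq_of_le_ten (by simpa using hk)) 9 (Or.inl rfl)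
  have hΦ9zero : ∀ w, Φ (slicePoint 0 0 0 w) 9 = 0 := fun w => by
    rw [hΦ9 0 0 0 w 0, slicePoint_zero, hΦ0]; rfl
  have hratio : ∀ s u v : ℝ, s ≠ 0 → |s| < ε → |u| < ε → |v| < ε →
      1 + Φ (slicePoint s u v (ε / 2)) 9
        = (1 + u) * (1 + Φ (slicePoint s 0 0 (ε / 2)) 9) := by
    intro s u v hs0 hs hu hv
    obtain ⟨hpU, hfp, hGp, hKp⟩ := hball _ (slicePoint_mem_ball hε hs hu hv habs)
    obtain ⟨hqU, hfq, hGq, -⟩ := hball _ (slicePoint_mem_ball hε hs habs0 habs0 habs)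
    have hp2 := hx2 _ hpU rfl
    have hp3 := hx3 _ hpU rfl
    have hq2 := hx2 _ hqU rfl
    have hq3 := hx3 _ hqU rfl
    have hKeq := quotient_eq_of_coords_eq hU hX2 hKd (n := 6)
      (fun p q h => htri 2 (by norm_num) (by norm_num) p q h 5 (Or.inl rfl)) hqU hpU rfl rfl
      (fun k hk => slicePoint_apply_eq (by omega))
    have hHeq := quotient_eq_of_coords_eq hU hX3 hHd (n := 8)
      (fun p q h => htri 3 (by norm_num) (by norm_num) p q h 7 (Or.inl rfl)) hqU hpU rfl rfl
      (fun k hk => slicePoint_apply_eq hk)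
    have hYeq : Φ (slicePoint s 0 0 (ε / 2)) 8 = Φ (slicePoint s u v (ε / 2)) 8 :=
      htri 3 (by norm_num) (by norm_num) _ _
        (fun k hk => slicePoint_apply_eq (by simpa using hk)) 8 (Or.inr rfl)
    rw [hKeq, hYeq] at hq2
    rw [hHeq] at hq3
    generalize hP : slicePoint s u v (ε / 2) = p at *
    generalize hQ : slicePoint s 0 0 (ε / 2) = q at *
    have p8 : p 8 = s := by rw [← hP]; rfl
    have p9 : p 9 = u := by rw [← hP]; rfl
    have p11 : p 11 = ε / 2 := by rw [← hP]; rfl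
    have q8 : q 8 = s := by rw [← hQ]; rfl
    have q9 : q 9 = 0 := by rw [← hQ]; rfl
    have q11 : q 11 = ε / 2 := by rw [← hQ]; rfl
    rw [p11, p8] at hp2
    rw [p11, p9] at hp3
    rw [q11, q8] at hq2
    rw [q11, q9] at hq3
    have hp : s * K p * (1 + Φ p 9) = (1 + u) * H p * Φ p 8 := by
      apply mul_left_cancel₀ (mul_ne_zero hε2 (mul_ne_zero hfp (mul_ne_zero hε2 hGp)))
      linear_combination (f p * (ε / 2 * G p) * (1 + Φ p 9)) * hp2
        - (f p * (ε / 2 * G p) * Φ p 8) * hp3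
    have hq : s * K p * (1 + Φ q 9) = H p * Φ p 8 := by
      apply mul_left_cancel₀ (mul_ne_zero hε2 (mul_ne_zero hfq (mul_ne_zero hε2 hGq)))
      linear_combination (f q * (ε / 2 * G q) * (1 + Φ q 9)) * hq2
        - (f q * (ε / 2 * G q) * Φ p 8) * hq3
    apply mul_left_cancel₀ (mul_ne_zero hs0 hKp)
    linear_combination hp - (1 + u) * hq
  have hX4 : ∀ u v : ℝ, |u| < ε → |v| < ε → Φ (slicePoint 0 u v 0) 9 = u := by
    intro u v hu hv
    have hlim : ∀ u v : ℝ, |u| < ε → |v| < ε →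
        Filter.Tendsto (fun s => 1 + Φ (slicePoint s u v (ε / 2)) 9) (nhdsWithin 0 {0}ᶜ)
          (nhds (1 + Φ (slicePoint 0 u v (ε / 2)) 9)) := by
      intro u v hu hv
      have hmem := (hball _ (slicePoint_mem_ball hε habs0 hu hv habs)).1
      have hc : ContinuousAt (fun s => Φ (slicePoint s u v (ε / 2))) 0 :=
        ContinuousAt.comp (g := Φ) (hΦd _ hmem).continuousAt
          (continuous_slicePoint_y3 u v (ε / 2)).continuousAt
      exact ((continuousAt_pi.1 hc 9).tendsto.const_add 1).mono_left nhdsWithin_le_nhds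
    have hsmall : ∀ᶠ s : ℝ in nhdsWithin 0 {0}ᶜ, |s| < ε :=
      nhdsWithin_le_nhds (continuous_abs.continuousAt.eventually_lt_const (by simpa using hε))
    have h := tendsto_nhds_unique_of_eventuallyEq (hlim u v hu hv)
      ((hlim 0 0 habs0 habs0).const_mul (1 + u)) (by
        filter_upwards [hsmall, self_mem_nhdsWithin] with s hs hs0
        exact hratio s u v hs0 hs hu hv)
    rw [hΦ9zero, hΦ9 0 u v _ 0] at h
    linarith
  have hΦ9d : DifferentiableAt ℝ (fun p => Φ p 9) 0 := differentiableAt_pi.1 (hΦd 0 h0U) 9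
  have hsmall : ∀ᶠ r : ℝ in nhds 0, |r| < ε :=
    continuous_abs.continuousAt.eventually_lt_const (by simpa using hε)
  have hX4x4 : pd (fun p => Φ p 9) 9 0 = 1 := pd_zero_of_eventually hΦ9d <| by
    filter_upwards [hsmall] with r hr
    rw [smul_e_nine, hX4 r 0 hr habs0, mul_one]
  have hX4y4 : pd (fun p => Φ p 9) 10 0 = 0 := pd_zero_of_eventually hΦ9d <| by
    filter_upwards [hsmall] with r hr
    rw [smul_e_ten, hX4 0 r habs0 hr, mul_zero]
  refine ⟨?_, hX4x4, hX4y4, ?_⟩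
  · have hcurve : Filter.Tendsto (fun w => slicePoint 0 0 0 w) (nhdsWithin 0 {0}ᶜ)
        (nhds (0 : E13)) := by
      have h := (continuous_slicePoint_x5 0 0 0).tendsto 0
      rw [slicePoint_zero] at h
      exact h.mono_left nhdsWithin_le_nhds
    refine tendsto_nhds_unique_of_eventuallyEq
      ((hHd 0 h0U).continuousAt.tendsto.comp hcurve)
      ((hfc.tendsto.mul hGc.tendsto).comp hcurve) ?_
    filter_upwards [hcurve.eventually (hU.mem_nhds h0U), self_mem_nhdsWithin] with w hwU hw
    have h := hx3 _ hwU rfl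
    rw [hΦ9zero, show slicePoint 0 0 0 w 11 = w from rfl,
      show slicePoint 0 0 0 w 9 = 0 from rfl] at h
    apply mul_left_cancel₀ (show w ≠ 0 from hw)
    simp only [Function.comp_apply]
    linear_combination h
  · have h := hcomp 0 h0U 9 (by decide) (by decide)
    rw [Z_zero, Z_apply_nine, map_add, map_smul] at h
    change pd (fun p => Φ p 9) 9 0 + c • pd (fun p => Φ p 9) 10 0 = _ at h
    rw [hX4x4, hX4y4] at h
    simpa using h.symm
end
end

section
/- Under the stated hypotheses on Φ and f, one has: Y4_{x4}(0) = 0, Y3_{y3}(0) = f(0)·G(0) ≠ 0, and consequently Y4_{y4}(0) = 1 and c·Y4_{y4}(0) = c̃. -/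
noncomputable section

/-- Two functions continuous on an open set agree there once they agree after multiplication by a
coordinate. -/
lemma eqOn_of_coord_mul_eq {U : Set E13} (hU : IsOpen U) (j : Fin 13) {a b : E13 → ℝ}
    (ha : ContinuousOn a U) (hb : ContinuousOn b U)
    (h : ∀ p ∈ U, p j * a p = p j * b p) : ∀ p ∈ U, a p = b p := by
  have hd : Dense ((fun p : E13 => p j) ⁻¹' ({0}ᶜ : Set ℝ)) :=
    (dense_compl_singleton (0 : ℝ)).preimage (isOpenMap_eval j)
  have heq : Set.EqOn a b (U ∩ (fun p : E13 => p j) ⁻¹' ({0}ᶜ : Set ℝ)) := fun p hp =>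
    mul_left_cancel₀ (show p j ≠ 0 from hp.2) (h p hp.1)
  exact heq.of_subset_closure ha hb Set.inter_subset_left (hd.open_subset_closure_inter hU)

/-- The derivative along a line on which the function is affine is the slope. -/
lemma fderiv_apply_eq_of_affine_on_line {F : E13 → ℝ} {p v : E13} (hF : DifferentiableAt ℝ F p)
    (a : ℝ) (h : ∀ᶠ s : ℝ in nhds 0, F (p + s • v) = F p + s * a) : fderiv ℝ F p v = a := by
  have h1 : HasDerivAt (fun s : ℝ => F (p + s • v)) (fderiv ℝ F p v) 0 :=
    hF.hasFDerivAt.hasLineDerivAt v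
  have h2 : HasDerivAt (fun s : ℝ => F p + s * a) a 0 := by
    simpa using ((hasDerivAt_id (0 : ℝ)).mul_const a).const_add (F p)
  exact h1.unique (h2.congr_of_eventuallyEq h)

/-- If `F = x_j · K` near a point with `x_j = 0`, then `∂F/∂x_j = K` there. -/
lemma fderiv_coord_mul {U : Set E13} (hU : IsOpen U) {F K : E13 → ℝ} {j : Fin 13}
    (hF : ∀ p ∈ U, F p = p j * K p) (hK : DifferentiableOn ℝ K U) {p : E13} (hp : p ∈ U)
    (hpj : p j = 0) (v : E13) : fderiv ℝ F p v = v j * K p := by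
  have hKp := (hK.differentiableAt (hU.mem_nhds hp)).hasFDerivAt
  have hj : HasFDerivAt (fun q : E13 => q j)
      (ContinuousLinearMap.proj (R := ℝ) (φ := fun _ : Fin 13 => ℝ) j) p := hasFDerivAt_apply j p
  have h := (hj.mul hKp).congr_of_eventuallyEq
    (Filter.eventually_of_mem (hU.mem_nhds hp) hF : F =ᶠ[nhds p] _)
  rw [h.fderiv]
  simp [hpj, mul_comm]

/-- The derivative of a function invariant under a translation is invariant. -/
lemma fderiv_add_of_invariant {F : E13 → ℝ} {v : E13} (h : ∀ p, F (p + v) = F p) (p : E13) :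
    fderiv ℝ F (p + v) = fderiv ℝ F p := by
  rw [← fderiv_comp_add_right]
  simp only [h]

/-- The bracket of `Z` multiplied by `x2`. -/
def innerField (p : E13) : E13 := e 0 + p 3 • e 1 + p 4 • e 2

/-- The bracket of `Z` multiplied by `x3`. -/
def middleField (p : E13) : E13 := e 3 + p 6 • e 4 + p 5 • innerField p

/-- The bracket of `Z` multiplied by `x5`. -/
def outerField (p : E13) : E13 :=
  p 8 • e 5 + (1 + p 9) • e 7 + (1 + p 10) • e 8 + p 7 • middleField p

lemma Z_eq (a : ℝ) (p : E13) : Z a p = e 9 + (a + p 12) • e 10 + p 11 • outerField p := rfl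

lemma continuous_innerField : Continuous innerField := by unfold innerField; fun_prop

lemma continuous_middleField : Continuous middleField := by
  have := continuous_innerField
  unfold middleField; fun_prop

lemma continuous_outerField : Continuous outerField := by
  have := continuous_middleField
  unfold outerField; fun_prop

/-- `Y4_{x4}(0) = 0`, `Y3_{y3}(0) = f(0)·G(0) ≠ 0`, and consequently `Y4_{y4}(0) = 1` and `c·Y4_{y4}(0) = c'`. -/
theorem final_relations_12312 (c c' : ℝ)
    (Φ : E13 → E13) (U : Set E13) (hU : IsOpen U) (h0U : (0 : E13) ∈ U)
    (hΦsmooth : ContDiffOn ℝ (⊤ : ℕ∞) Φ U) (hΦ0 : Φ 0 = 0)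
    (hdiffeo : Function.Bijective (fderiv ℝ Φ 0))
    -- the components `T, X0, Y0` (indices 0,1,2) depend only on `t, x0, y0`
    (htri0 : ∀ p q : E13, (∀ k : Fin 13, (k : ℕ) ≤ 2 → p k = q k) →
      ∀ i : Fin 13, (i : ℕ) ≤ 2 → Φ p i = Φ q i)
    -- for `1 ≤ j ≤ 5`, the components `Xj, Yj` (indices 2j+1, 2j+2)
    -- depend only on `t, x0, y0, x1, y1, ..., xj, yj`
    (htri : ∀ j : ℕ, 1 ≤ j → j ≤ 5 → ∀ p q : E13,
      (∀ k : Fin 13, (k : ℕ) ≤ 2 * j + 2 → p k = q k) →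
      ∀ i : Fin 13, ((i : ℕ) = 2 * j + 1 ∨ (i : ℕ) = 2 * j + 2) → Φ p i = Φ q i)
    (K H G : E13 → ℝ)
    (hKs : ContDiffOn ℝ (⊤ : ℕ∞) K U) (hHs : ContDiffOn ℝ (⊤ : ℕ∞) H U) (hGs : ContDiffOn ℝ (⊤ : ℕ∞) G U)
    (hK0 : K 0 ≠ 0) (hH0 : H 0 ≠ 0) (hG0 : G 0 ≠ 0)
    -- `X2 = x2·K`, `X3 = x3·H`, `X5 = x5·G`
    (hX2 : ∀ p ∈ U, Φ p 5 = p 5 * K p)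
    (hX3 : ∀ p ∈ U, Φ p 7 = p 7 * H p)
    (hX5 : ∀ p ∈ U, Φ p 11 = p 11 * G p)
    (f : E13 → ℝ) (hfs : ContDiffOn ℝ (⊤ : ℕ∞) f U) (hf0 : f 0 ≠ 0)
    -- `dΦ(p)·Z_{1,c}(p) − f(p)·Z_{1,c'}(Φ(p)) ∈ span{∂_{x5}, ∂_{y5}}` near 0
    (hconj : ∀ p ∈ U, fderiv ℝ Φ p (Z c p) - f p • Z c' (Φ p) ∈
      Submodule.span ℝ ({e 11, e 12} : Set E13)) :
    pd (fun p => Φ p 10) 9 0 = 0 ∧ pd (fun p => Φ p 8) 8 0 = f 0 * G 0 ∧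
      f 0 * G 0 ≠ 0 ∧ pd (fun p => Φ p 10) 10 0 = 1 ∧
      c * pd (fun p => Φ p 10) 10 0 = c' := by
  have hΦi (i : Fin 13) : ContDiffOn ℝ (⊤ : ℕ∞) (fun p => Φ p i) U := contDiffOn_pi.1 hΦsmooth i
  have hd (i : Fin 13) (p : E13) (hp : p ∈ U) : DifferentiableAt ℝ (fun q => Φ q i) p :=
    ((hΦi i).differentiableOn (by simp)).differentiableAt (hU.mem_nhds hp)
  have hcD (i : Fin 13) {W : E13 → E13} (hW : Continuous W) :
      ContinuousOn (fun p => fderiv ℝ (fun q => Φ q i) p (W p)) U :=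
    ((hΦi i).continuousOn_fderiv_of_isOpen hU (by simp)).clm_apply hW.continuousOn
  have hcomp (i : Fin 13) (p : E13) (hp : p ∈ U) (v : E13) :
      fderiv ℝ Φ p v i = fderiv ℝ (fun q => Φ q i) p v := by
    rw [fderiv_pi (fun i => hd i p hp)]; rfl
  have hinv (i j : Fin 13) (hij : max 2 (2 * (((i : ℕ) + 1) / 2)) < (j : ℕ)) (s : ℝ) (p : E13) :
      Φ (p + s • e j) i = Φ p i := by
    have hz (n : ℕ) (hn : n < j) (k : Fin 13) (hk : (k : ℕ) ≤ n) : (p + s • e j) k = p k := by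
      have : k ≠ j := by rintro rfl; omega
      simp [e, this]
    rcases le_or_gt (i : ℕ) 2 with hi | hi
    · exact htri0 _ _ (hz 2 (by omega)) i hi
    · exact htri (((i : ℕ) - 1) / 2) (by omega) (by omega) _ _ (hz _ (by omega)) i (by omega)
  have hkill (i j : Fin 13) (hij : max 2 (2 * (((i : ℕ) + 1) / 2)) < (j : ℕ)) (p : E13)
      (hp : p ∈ U) : fderiv ℝ (fun q => Φ q i) p (e j) = 0 :=
    fderiv_apply_eq_of_affine_on_line (hd i p hp) 0
      (Filter.Eventually.of_forall fun s => by simp [hinv i j hij s p])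
  have hshift (i j : Fin 13) (hij : max 2 (2 * (((i : ℕ) + 1) / 2)) < (j : ℕ)) (s : ℝ) :
      fderiv ℝ (fun q => Φ q i) (s • e j) = fderiv ℝ (fun q => Φ q i) 0 := by
    simpa using fderiv_add_of_invariant (F := fun q => Φ q i) (hinv i j hij s) 0
  have hZ (i : Fin 13) (h11 : i ≠ 11) (h12 : i ≠ 12) (p : E13) (hp : p ∈ U) :
      fderiv ℝ (fun q => Φ q i) p (Z c p) = f p * Z c' (Φ p) i := by
    obtain ⟨a, b, hab⟩ := Submodule.mem_span_pair.1 (hconj p hp)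
    have := congrFun hab i
    simp [e, h11, h12, hcomp i p hp] at this
    linarith
  have hfc := hfs.continuousOn
  have hGc := hGs.continuousOn
  have hHc := hHs.continuousOn
  have hKc := hKs.continuousOn
  have hΦc (i : Fin 13) : ContinuousOn (fun p => Φ p i) U := (hΦi i).continuousOn
  have houter (i : Fin 13) (hi : (i : ℕ) ≤ 8) : ∀ p ∈ U,
      fderiv ℝ (fun q => Φ q i) p (outerField p) = f p * G p * outerField (Φ p) i := by
    refine eqOn_of_coord_mul_eq hU 11 (hcD i continuous_outerField) ?_ fun p hp => ?_
    · exact (hfc.mul hGc).mul (((continuous_apply i).comp continuous_outerField).comp_continuousOn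
        hΦsmooth.continuousOn)
    · have h := hZ i (by rintro rfl; simp at hi) (by rintro rfl; simp at hi) p hp
      have h9 : i ≠ 9 := by rintro rfl; simp at hi
      have h10 : i ≠ 10 := by rintro rfl; simp at hi
      rw [Z_eq, Z_eq, map_add, map_add, map_smul, map_smul,
        hkill i 9 (by simp; omega) p hp, hkill i 10 (by simp; omega) p hp] at h
      simp [e, h9, h10, hX5 p hp] at h
      linarith
  have hmiddle : ∀ p ∈ U, fderiv ℝ (fun q => Φ q 0) p (middleField p)
      = f p * G p * H p * (Φ p 5) := by
    refine eqOn_of_coord_mul_eq hU 7 (hcD 0 continuous_middleField)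
      (((hfc.mul hGc).mul hHc).mul (hΦc 5)) fun p hp => ?_
    have h := houter 0 (by simp) p hp
    rw [outerField] at h
    simp only [map_add, map_smul] at h
    rw [hkill 0 5 (by simp) p hp, hkill 0 7 (by simp) p hp, hkill 0 8 (by simp) p hp] at h
    simp [outerField, middleField, innerField, e, hX3 p hp] at h
    simp only [middleField, innerField, e, map_add, map_smul, smul_eq_mul] at h ⊢
    linarith
  have hinner : ∀ p ∈ U, fderiv ℝ (fun q => Φ q 0) p (innerField p)
      = f p * G p * H p * K p := by
    refine eqOn_of_coord_mul_eq hU 5 (hcD 0 continuous_innerField)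
      (((hfc.mul hGc).mul hHc).mul hKc) fun p hp => ?_
    have h := hmiddle p hp
    rw [middleField] at h
    simp only [map_add, map_smul] at h
    rw [hkill 0 3 (by simp) p hp, hkill 0 4 (by simp) p hp, hX2 p hp] at h
    simp only [smul_eq_mul] at h
    linarith
  have hd2 := fun p hp hpj v => fderiv_coord_mul hU hX2 (hKs.differentiableOn (by simp))
    (p := p) hp hpj v
  have hd3 := fun p hp hpj v => fderiv_coord_mul hU hX3 (hHs.differentiableOn (by simp))
    (p := p) hp hpj v
  -- `K`, `H` and `f G` are constant along the `x4` and `y4` axes.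
  have hKv (j : Fin 13) (hj : 8 < (j : ℕ)) (s : ℝ) (hs : s • e j ∈ U) : K (s • e j) = K 0 := by
    have hj5 : (5 : Fin 13) ≠ j := by rintro rfl; simp at hj
    have h1 := hd2 (s • e j) hs (by simp [e, hj5]) (e 5)
    have h2 := hd2 0 h0U rfl (e 5)
    rw [hshift 5 j (by simp; omega) s, h2] at h1
    simpa [e] using h1.symm
  have hHv (j : Fin 13) (hj : 8 < (j : ℕ)) (s : ℝ) (hs : s • e j ∈ U) : H (s • e j) = H 0 := by
    have hj7 : (7 : Fin 13) ≠ j := by rintro rfl; simp at hj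
    have h1 := hd3 (s • e j) hs (by simp [e, hj7]) (e 7)
    have h2 := hd3 0 h0U rfl (e 7)
    rw [hshift 7 j (by simp; omega) s, h2] at h1
    simpa [e] using h1.symm
  have hfG (j : Fin 13) (hj : 8 < (j : ℕ)) (s : ℝ) (hs : s • e j ∈ U) :
      f (s • e j) * G (s • e j) = f 0 * G 0 := by
    have hj3 : (3 : Fin 13) ≠ j := by rintro rfl; simp at hj
    have hj4 : (4 : Fin 13) ≠ j := by rintro rfl; simp at hj
    have h1 := hinner _ hs
    have h2 := hinner 0 h0U
    have hfield : innerField (s • e j) = innerField 0 := by simp [innerField, e, hj3, hj4]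
    rw [hfield, hshift 0 j (by simp; omega) s, h2, hKv j hj s hs, hHv j hj s hs] at h1
    exact (mul_right_cancel₀ hH0 (mul_right_cancel₀ hK0 h1)).symm
  have hfG0 : f 0 * G 0 ≠ 0 := mul_ne_zero hf0 hG0
  have hline (j : Fin 13) : Filter.Tendsto (fun s : ℝ => s • e j) (nhds 0) (nhds 0) := by
    have : Continuous fun s : ℝ => s • e j := by fun_prop
    simpa using this.tendsto 0
  have hUline (j : Fin 13) : ∀ᶠ s : ℝ in nhds 0, s • e j ∈ U :=
    (hline j).eventually (hU.mem_nhds h0U)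
  -- `Y3` vanishes along the `x3` axis.
  have hY3x3 : fderiv ℝ (fun q => Φ q 8) 0 (e 7) = 0 := by
    refine fderiv_apply_eq_of_affine_on_line (hd 8 0 h0U) 0 ?_
    have hne : ∀ᶠ s : ℝ in nhds 0, f (s • e 7) * G (s • e 7) ≠ 0 :=
      (hline 7).eventually
        (((hfc.mul hGc).continuousAt (hU.mem_nhds h0U)).eventually_ne hfG0)
    filter_upwards [hUline 7, hne] with s hs hs0
    have h := houter 5 (by simp) _ hs
    rw [hd2 _ hs (by simp [e])] at h
    simp [outerField, middleField, innerField, e] at h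
    have h' := h.resolve_left (by simpa [e] using hs0)
    simpa [hΦ0, e] using h'
  have houter_axis (x : E13) (hx8 : x 8 = 0) (hx7 : x 7 = 0) (i : Fin 13) :
      fderiv ℝ (fun q => Φ q i) x (outerField x) = (1 + x 9) * fderiv ℝ (fun q => Φ q i) x (e 7)
        + (1 + x 10) * fderiv ℝ (fun q => Φ q i) x (e 8) := by
    simp [outerField, hx8, hx7]
  have hΦ7 (x : E13) (hx : x ∈ U) (hx7 : x 7 = 0) : Φ x 7 = 0 := by simp [hX3 x hx, hx7]
  -- The `y3` component of the conjugacy relation along the `x4` and `y4` axes.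
  have hY (j : Fin 13) (hj : 8 < (j : ℕ)) (s : ℝ) (hs : s • e j ∈ U) :
      (1 + (s • e j : E13) 10) * fderiv ℝ (fun q => Φ q 8) 0 (e 8)
        = f 0 * G 0 * (1 + Φ (s • e j) 10) := by
    have hj7 : (7 : Fin 13) ≠ j := by rintro rfl; simp at hj
    have hj8 : (8 : Fin 13) ≠ j := by rintro rfl; simp at hj
    have h := houter 8 (by simp) _ hs
    rw [houter_axis _ (by simp [e, hj8]) (by simp [e, hj7]), hshift 8 j (by simp; omega) s, hY3x3,
      hfG j hj s hs] at h
    simpa [outerField, middleField, innerField, e, hΦ7 _ hs (by simp [e, hj7])] using h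
  -- The `x3` component of the conjugacy relation along the `x4` and `y4` axes.
  have hX (j : Fin 13) (hj : 8 < (j : ℕ)) (s : ℝ) (hs : s • e j ∈ U) :
      (1 + (s • e j : E13) 9) * H 0 = f 0 * G 0 * (1 + Φ (s • e j) 9) := by
    have hj7 : (7 : Fin 13) ≠ j := by rintro rfl; simp at hj
    have hj8 : (8 : Fin 13) ≠ j := by rintro rfl; simp at hj
    have h := houter 7 (by simp) _ hs
    rw [houter_axis _ (by simp [e, hj8]) (by simp [e, hj7]), hd3 _ hs (by simp [e, hj7]),
      hd3 _ hs (by simp [e, hj7]), hfG j hj s hs, hHv j hj s hs] at h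
    simpa [outerField, middleField, innerField, e, hΦ7 _ hs (by simp [e, hj7])] using h
  have hY33 : fderiv ℝ (fun q => Φ q 8) 0 (e 8) = f 0 * G 0 := by
    simpa [hΦ0] using hY 9 (by simp) 0 (by simpa using h0U)
  have hH : H 0 = f 0 * G 0 := by
    simpa [hΦ0] using hX 9 (by simp) 0 (by simpa using h0U)
  have hYc (j : Fin 13) (hj : 8 < (j : ℕ)) :
      fderiv ℝ (fun q => Φ q 10) 0 (e j) = (e j : E13) 10 := by
    refine fderiv_apply_eq_of_affine_on_line (hd 10 0 h0U) _ ?_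
    filter_upwards [hUline j] with s hs
    have h := hY j hj s hs
    rw [hY33, mul_comm] at h
    have h' := mul_left_cancel₀ hfG0 h
    simp only [Pi.smul_apply, smul_eq_mul, zero_add, hΦ0, Pi.zero_apply] at h' ⊢
    linarith
  have hXc (j : Fin 13) (hj : 8 < (j : ℕ)) :
      fderiv ℝ (fun q => Φ q 9) 0 (e j) = (e j : E13) 9 := by
    refine fderiv_apply_eq_of_affine_on_line (hd 9 0 h0U) _ ?_
    filter_upwards [hUline j] with s hs
    have h := hX j hj s hs
    rw [hH, mul_comm] at h
    have h' := mul_left_cancel₀ hfG0 h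
    simp only [Pi.smul_apply, smul_eq_mul, zero_add, hΦ0, Pi.zero_apply] at h' ⊢
    linarith
  have hZ0 (a : ℝ) : Z a 0 = e 9 + a • e 10 := by simp [Z]
  have hf1 : f 0 = 1 := by
    have h := hZ 9 (by decide) (by decide) 0 h0U
    rw [hΦ0, hZ0, hZ0, map_add, map_smul, hXc 9 (by simp), hXc 10 (by simp)] at h
    simpa [e] using h.symm
  have hcc : c = c' := by
    have h := hZ 10 (by decide) (by decide) 0 h0U
    rw [hΦ0, hZ0, hZ0, map_add, map_smul, hYc 9 (by simp), hYc 10 (by simp), hf1] at h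
    simpa [e] using h
  have hY44 : pd (fun p => Φ p 10) 10 0 = 1 := by simpa [pd, e] using hYc 10 (by simp)
  refine ⟨?_, hY33, hfG0, hY44, by rw [hY44, mul_one, hcc]⟩
  simpa [pd, e] using hYc 9 (by simp)
end
end
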